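/- (Rigidity / pure unrectifiability of the Heisenberg group) Let n ≥ 1 and m ≥ 1. There is no bi-Lipschitz map from a nonempty open subset of the Heisenberg group H(n), equipped with the Carnot–Carathéodory distance d_CC, into the Euclidean space ℝ^m: i.e. there is no map f: U → ℝ^m, with U ⊆ ℝ^{2n+1} nonempty and open in the d_CC topology, and constants 0 < c ≤ C with c·d_CC(p,q) ≤ ‖f(p) − f(q)‖ ≤ C·d_CC(p,q) for all p,q ∈ U. -/

import Mathlib

open Filter Topology Set MeasureTheory

noncomputable section

/-- The underlying space `ℝ^{2n}` of the horizontal part of the Heisenberg group. -/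
abbrev Epl (n : ℕ) := EuclideanSpace ℝ (Fin (2 * n))

def idxA {n : ℕ} (i : Fin n) : Fin (2 * n) := ⟨i, by have := i.isLt; omega⟩
def idxB {n : ℕ} (i : Fin n) : Fin (2 * n) := ⟨n + i, by have := i.isLt; omega⟩

/-- The standard symplectic form on `ℝ^{2n}`:
`ω(x,y) = Σ_i (x_i y_{n+i} - x_{n+i} y_i)`. -/
def omegaForm {n : ℕ} (x y : Epl n) : ℝ :=
  ∑ i : Fin n, (x (idxA i) * y (idxB i) - x (idxB i) * y (idxA i))

/-- A point of the Heisenberg group `H(n) = ℝ^{2n} × ℝ`. -/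
abbrev Hpt (n : ℕ) := Epl n × ℝ

/-- Heisenberg group multiplication `(x,x̄)·(y,ȳ) = (x+y, x̄+ȳ+½ω(x,y))`. -/
def hMul {n : ℕ} (p q : Hpt n) : Hpt n :=
  (p.1 + q.1, p.2 + q.2 + (1 / 2) * omegaForm p.1 q.1)

/-- Heisenberg group inverse. -/
def hInv {n : ℕ} (p : Hpt n) : Hpt n := (-p.1, -p.2)

/-- Heisenberg dilatation `δ_ε(x,x̄) = (εx, ε²x̄)`. -/
def hDil {n : ℕ} (ε : ℝ) (p : Hpt n) : Hpt n := (ε • p.1, ε ^ 2 * p.2)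

/-- `γ'` is an a.e. derivative of the horizontal Lipschitz curve `(γ, γb)` on `[0,1]`:
a.e. `γ` has derivative `γ' t` and `γb` has derivative `½ ω(γ t, γ' t)`. -/
def IsHorizontalLift {n : ℕ} (γ : ℝ → Epl n) (γb : ℝ → ℝ) (γ' : ℝ → Epl n) : Prop :=
  ∀ᵐ t ∂(volume.restrict (Set.Icc (0 : ℝ) 1)),
    HasDerivAt γ (γ' t) t ∧ HasDerivAt γb ((1 / 2) * omegaForm (γ t) (γ' t)) t

/-- The Carnot–Carathéodory distance on the Heisenberg group `H(n)`:
the infimum of `∫₀¹ ‖γ'(t)‖ dt` over horizontal Lipschitz curves joining the points. -/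
def ccDist (n : ℕ) (p q : Hpt n) : ℝ :=
  sInf {L : ℝ | ∃ (γ : ℝ → Epl n) (γb : ℝ → ℝ) (γ' : ℝ → Epl n) (K : NNReal),
    LipschitzOnWith K (fun t => ((γ t, γb t) : Hpt n)) (Set.Icc 0 1) ∧
    (γ 0, γb 0) = p ∧ (γ 1, γb 1) = q ∧ IsHorizontalLift γ γb γ' ∧
    L = ∫ t in (0 : ℝ)..1, ‖γ' t‖}

open scoped ENNReal NNReal

/-- If bounded continuous functions `A k` converge almost everywhere, and the measure-preserving
maps `θ k` converge pointwise to the identity, then `A k` and `A k ∘ θ k` are asymptotically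
close in `L¹` of a set `B` all of whose images under `θ k` lie in a set of finite measure. -/
theorem tendsto_lintegral_enorm_sub_comp {P E : Type*} [TopologicalSpace P] [MeasurableSpace P]
    [BorelSpace P] [NormedAddCommGroup E] [SecondCountableTopology E] {μ : Measure P}
    {A : ℕ → P → E} (hA : ∀ k, Continuous (A k)) {C : ℝ≥0} (hC : ∀ k p, ‖A k p‖ₑ ≤ C)
    (hlim : ∀ᵐ p ∂μ, ∃ l, Tendsto (fun k => A k p) atTop (𝓝 l))
    {θ : ℕ → P → P} (hθ : ∀ k, MeasurePreserving (θ k) μ μ)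
    (hθid : ∀ p, Tendsto (fun k => θ k p) atTop (𝓝 p))
    {B B' : Set P} (hB' : MeasurableSet B') (hBB' : B ⊆ B') (hfin : μ B' ≠ ∞)
    (hmaps : ∀ k, MapsTo (θ k) B B') :
    Tendsto (fun k => ∫⁻ p in B, ‖A k p - A k (θ k p)‖ₑ ∂μ) atTop (𝓝 0) := by
  borelize E
  have hAm : ∀ k, Measurable (A k) := fun k => (hA k).measurable
  obtain ⟨D, hD, hDlim⟩ := exists_stronglyMeasurable_limit_of_tendsto_ae
    (fun k => (hA k).aestronglyMeasurable) hlim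
  have hDm : Measurable D := hD.measurable
  have hDC : ∀ᵐ p ∂μ, ‖D p‖ₑ ≤ C := by
    filter_upwards [hDlim] with p hp
    exact le_of_tendsto' hp.enorm fun k => hC k p
  have hμB : μ B ≠ ∞ := ne_top_of_le_ne_top hfin (measure_mono hBB')
  have hCC : ∀ s : Set P, μ s ≠ ∞ → ∫⁻ _ in s, ((C : ℝ≥0∞) + C) ∂μ ≠ ∞ := fun s hs => by
    rw [setLIntegral_const]
    exact ENNReal.mul_ne_top (by simp) hs
  set e : ℕ → ℝ≥0∞ := fun k => ∫⁻ p in B', ‖A k p - D p‖ₑ ∂μ with he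
  have he0 : Tendsto e atTop (𝓝 0) := by
    have := tendsto_lintegral_of_dominated_convergence (μ := μ.restrict B')
      (F := fun k p => ‖A k p - D p‖ₑ) (f := fun _ => 0) (fun _ => (C : ℝ≥0∞) + C)
      (fun k => ((hAm k).sub hDm).enorm)
      (fun k => by
        filter_upwards [ae_restrict_of_ae hDC] with p hp
        exact (enorm_sub_le).trans (add_le_add (hC k p) hp))
      (hCC _ hfin)
      (by
        filter_upwards [ae_restrict_of_ae hDlim] with p hp
        simpa using (hp.sub_const (D p)).enorm)
    simpa using this
  have hj : ∀ j, Tendsto (fun k => ∫⁻ p in B, ‖A j p - A j (θ k p)‖ₑ ∂μ) atTop (𝓝 0) := by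
    intro j
    have := tendsto_lintegral_of_dominated_convergence (μ := μ.restrict B)
      (F := fun k p => ‖A j p - A j (θ k p)‖ₑ) (f := fun _ => 0) (fun _ => (C : ℝ≥0∞) + C)
      (fun k => ((hAm j).sub ((hAm j).comp (hθ k).measurable)).enorm)
      (fun k => Eventually.of_forall fun p =>
        (enorm_sub_le).trans (add_le_add (hC j p) (hC j _)))
      (hCC _ hμB)
      (Eventually.of_forall fun p => by
        have h1 : Tendsto (fun k => A j (θ k p)) atTop (𝓝 (A j p)) :=
          ((hA j).tendsto p).comp (hθid p)
        simpa using (h1.const_sub (A j p)).enorm)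
    simpa using this
  have hshift : ∀ k j, ∫⁻ p in B, ‖A j (θ k p) - D (θ k p)‖ₑ ∂μ ≤ e j := by
    intro k j
    calc ∫⁻ p in B, ‖A j (θ k p) - D (θ k p)‖ₑ ∂μ
        ≤ ∫⁻ p in θ k ⁻¹' B', ‖A j (θ k p) - D (θ k p)‖ₑ ∂μ :=
          lintegral_mono_set (hmaps k)
      _ = e j := (hθ k).setLIntegral_comp_preimage hB' (f := fun p => ‖A j p - D p‖ₑ)
          ((hAm j).sub hDm).enorm
  have hkey : ∀ j k, ∫⁻ p in B, ‖A k p - A k (θ k p)‖ₑ ∂μ ≤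
      e k + e j + (∫⁻ p in B, ‖A j p - A j (θ k p)‖ₑ ∂μ) + e j + e k := by
    intro j k
    have m1 : ∀ i, Measurable fun p => ‖A i p - D p‖ₑ := fun i => ((hAm i).sub hDm).enorm
    have m2 : ∀ i, Measurable fun p => ‖A i (θ k p) - D (θ k p)‖ₑ :=
      fun i => (m1 i).comp (hθ k).measurable
    have m3 : Measurable fun p => ‖A j p - A j (θ k p)‖ₑ :=
      ((hAm j).sub ((hAm j).comp (hθ k).measurable)).enorm
    calc ∫⁻ p in B, ‖A k p - A k (θ k p)‖ₑ ∂μ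
        ≤ ∫⁻ p in B, (‖A k p - D p‖ₑ + ‖A j p - D p‖ₑ + ‖A j p - A j (θ k p)‖ₑ
            + ‖A j (θ k p) - D (θ k p)‖ₑ + ‖A k (θ k p) - D (θ k p)‖ₑ) ∂μ := by
          refine lintegral_mono fun p => ?_
          have : A k p - A k (θ k p) = (A k p - D p) - (A j p - D p) + (A j p - A j (θ k p))
            + (A j (θ k p) - D (θ k p)) - (A k (θ k p) - D (θ k p)) := by abel
          rw [this]
          refine (enorm_sub_le).trans ?_
          gcongr
          refine (enorm_add_le _ _).trans ?_
          gcongr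
          refine (enorm_add_le _ _).trans ?_
          gcongr
          exact enorm_sub_le
      _ = (∫⁻ p in B, ‖A k p - D p‖ₑ ∂μ) + (∫⁻ p in B, ‖A j p - D p‖ₑ ∂μ)
          + (∫⁻ p in B, ‖A j p - A j (θ k p)‖ₑ ∂μ)
          + (∫⁻ p in B, ‖A j (θ k p) - D (θ k p)‖ₑ ∂μ)
          + (∫⁻ p in B, ‖A k (θ k p) - D (θ k p)‖ₑ ∂μ) := by
          rw [lintegral_add_right _ (m2 k), lintegral_add_right _ (m2 j),
            lintegral_add_right _ m3, lintegral_add_right _ (m1 j)]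
      _ ≤ _ := by
          gcongr
          · exact lintegral_mono_set hBB'
          · exact lintegral_mono_set hBB'
          · exact hshift k j
          · exact hshift k k
  have hlimsup : ∀ j, limsup (fun k => ∫⁻ p in B, ‖A k p - A k (θ k p)‖ₑ ∂μ) atTop
      ≤ e j + e j := by
    intro j
    have : Tendsto (fun k => e k + e j + (∫⁻ p in B, ‖A j p - A j (θ k p)‖ₑ ∂μ) + e j + e k)
        atTop (𝓝 (0 + e j + 0 + e j + 0)) :=
      (((he0.add tendsto_const_nhds).add (hj j)).add tendsto_const_nhds).add he0
    have h2 := limsup_le_limsup (f := atTop) (Eventually.of_forall (hkey j))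
    rw [this.limsup_eq] at h2
    simpa using h2
  have hzero : limsup (fun k => ∫⁻ p in B, ‖A k p - A k (θ k p)‖ₑ ∂μ) atTop ≤ 0 :=
    ge_of_tendsto' (by simpa using he0.add he0) hlimsup
  exact tendsto_of_le_liminf_of_limsup_le zero_le hzero

/-- Difference quotients at step `1 / (k + 1)` along a measurable measure-preserving flow of a
continuous function that is Lipschitz along the flow converge almost everywhere. -/
theorem ae_exists_tendsto_flow_quotient {P E : Type*} [TopologicalSpace P] [MeasurableSpace P]
    [BorelSpace P] [NormedAddCommGroup E] [NormedSpace ℝ E] [FiniteDimensional ℝ E]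
    {μ : Measure P} [SFinite μ] {φ : ℝ → P → P} (hφ : Measurable fun q : ℝ × P => φ q.1 q.2)
    (hadd : ∀ s t p, φ t (φ s p) = φ (s + t) p) (hzero : ∀ p, φ 0 p = p)
    (hmp : ∀ s, MeasurePreserving (φ s) μ μ)
    {F : P → E} (hF : Continuous F) {C : ℝ≥0} (hL : ∀ t p, ‖F (φ t p) - F p‖ ≤ C * |t|) :
    ∀ᵐ p ∂μ, ∃ l, Tendsto
      (fun k : ℕ => ((k : ℝ) + 1) • (F (φ (1 / ((k : ℝ) + 1)) p) - F p)) atTop (𝓝 l) := by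
  borelize E
  have : ProperSpace E := FiniteDimensional.proper ℝ E
  have : CompleteSpace E := FiniteDimensional.complete ℝ E
  set G : Set P := {p | ∃ l, Tendsto
    (fun k : ℕ => ((k : ℝ) + 1) • (F (φ (1 / ((k : ℝ) + 1)) p) - F p)) atTop (𝓝 l)} with hG
  have hGm : MeasurableSet G := by
    refine measurableSet_exists_tendsto (f := fun (k : ℕ) p =>
      ((k : ℝ) + 1) • (F (φ (1 / ((k : ℝ) + 1)) p) - F p)) fun k => ?_
    exact ((hF.measurable.comp (hmp _).measurable).sub hF.measurable).const_smul _
  have hline : ∀ p, ∀ᵐ s ∂(volume : Measure ℝ), φ s p ∈ G := by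
    intro p
    have hLip : LipschitzWith C fun s => F (φ s p) := by
      refine LipschitzWith.of_dist_le_mul fun s t => ?_
      have := hL (s - t) (φ t p)
      rw [hadd, add_sub_cancel] at this
      rwa [dist_eq_norm, Real.dist_eq]
    filter_upwards [hLip.ae_differentiableAt (μ := volume)] with s hs
    refine ⟨deriv (fun s => F (φ s p)) s, ?_⟩
    have h1 := hs.hasDerivAt.tendsto_slope_zero
    have h2 : Tendsto (fun k : ℕ => 1 / ((k : ℝ) + 1)) atTop (𝓝[≠] 0) :=
      tendsto_nhdsWithin_iff.2 ⟨tendsto_one_div_add_atTop_nhds_zero_nat,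
        Eventually.of_forall fun k => by
          simp only [mem_compl_iff, mem_singleton_iff]; positivity⟩
    refine (h1.comp h2).congr fun k => ?_
    simp [hadd]
  have hm : MeasurableSet {x : P × ℝ | φ x.2 x.1 ∈ G} :=
    (hφ.comp measurable_swap) hGm
  have h3 : ∀ᵐ s ∂(volume : Measure ℝ), ∀ᵐ p ∂μ, φ s p ∈ G :=
    (Measure.ae_ae_comm (p := fun p s => φ s p ∈ G) hm).1 (Eventually.of_forall hline)
  obtain ⟨s, hs⟩ := h3.exists
  have h4 := (hmp (-s)).quasiMeasurePreserving.ae hs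
  filter_upwards [h4] with p hp
  rwa [hadd, neg_add_cancel, hzero] at hp

section ModelCoordinates

/-- The flow of the vector field `∂_x` on `ℝ³`. -/
def flowX (t : ℝ) (p : ℝ × ℝ × ℝ) : ℝ × ℝ × ℝ := (p.1 + t, p.2.1, p.2.2)

/-- The flow of the vector field `∂_y + x ∂_z` on `ℝ³`. -/
def flowY (t : ℝ) (p : ℝ × ℝ × ℝ) : ℝ × ℝ × ℝ := (p.1, p.2.1 + t, p.2.2 + t * p.1)

theorem measurePreserving_flowX (t : ℝ) : MeasurePreserving (flowX t) volume volume :=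
  (measurePreserving_add_right volume t).prod (MeasurePreserving.id volume)

theorem measurePreserving_flowY (t : ℝ) : MeasurePreserving (flowY t) volume volume := by
  refine (MeasurePreserving.id (volume : Measure ℝ)).skew_product
    (g := fun x (q : ℝ × ℝ) => (q.1 + t, q.2 + t * x)) (by fun_prop) ?_
  refine Eventually.of_forall fun x => ?_
  exact (measurePreserving_add_right (volume : Measure (ℝ × ℝ)) (t, t * x)).map_eq

theorem continuous_flowX : Continuous fun q : ℝ × (ℝ × ℝ × ℝ) => flowX q.1 q.2 := by
  unfold flowX; fun_prop

theorem continuous_flowY : Continuous fun q : ℝ × (ℝ × ℝ × ℝ) => flowY q.1 q.2 := by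
  unfold flowY; fun_prop

variable {E : Type*} [NormedAddCommGroup E] {F : ℝ × ℝ × ℝ → E} {C : ℝ≥0}

theorem norm_sub_vertical_le (hX : ∀ t p, ‖F (flowX t p) - F p‖ ≤ C * |t|)
    (hY : ∀ t p, ‖F (flowY t p) - F p‖ ≤ C * |t|) (x y z s : ℝ) :
    ‖F (x, y, z + s) - F (x, y, z)‖ ≤ 4 * C * √|s| := by
  have key : ∀ z t : ℝ, ‖F (x, y, z + t ^ 2) - F (x, y, z)‖ ≤ 4 * C * |t| := by
    intro z t
    have h1 := hX t (x, y, z)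
    have h2 := hY t (x + t, y, z)
    have h3 := hX (-t) (x + t, y + t, z + t * (x + t))
    have h4 := hY (-t) (x, y + t, z + t * (x + t))
    simp only [flowX, flowY, add_neg_cancel_right, abs_neg] at h1 h2 h3 h4
    rw [show z + t * (x + t) + -t * x = z + t ^ 2 by ring] at h4
    rw [show F (x, y, z + t ^ 2) - F (x, y, z) =
      (F (x, y, z + t ^ 2) - F (x, y + t, z + t * (x + t)))
      + (F (x, y + t, z + t * (x + t)) - F (x + t, y + t, z + t * (x + t)))
      + (F (x + t, y + t, z + t * (x + t)) - F (x + t, y, z))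
      + (F (x + t, y, z) - F (x, y, z)) by abel]
    linarith [norm_add₄_le (a := F (x, y, z + t ^ 2) - F (x, y + t, z + t * (x + t)))
      (b := F (x, y + t, z + t * (x + t)) - F (x + t, y + t, z + t * (x + t)))
      (c := F (x + t, y + t, z + t * (x + t)) - F (x + t, y, z))
      (d := F (x + t, y, z) - F (x, y, z))]
  have hsq : √|s| ^ 2 = |s| := Real.sq_sqrt (abs_nonneg s)
  rcases le_total 0 s with hs | hs
  · have := key z (√|s|)
    rw [hsq, abs_of_nonneg (Real.sqrt_nonneg _)] at this
    rwa [show z + |s| = z + s by rw [abs_of_nonneg hs]] at this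
  · have := key (z + s) (√|s|)
    rw [hsq, abs_of_nonneg (Real.sqrt_nonneg _), norm_sub_rev] at this
    rwa [show z + s + |s| = z by rw [abs_of_nonpos hs]; ring] at this

theorem continuous_of_lipschitz_along_flows (hX : ∀ t p, ‖F (flowX t p) - F p‖ ≤ C * |t|)
    (hY : ∀ t p, ‖F (flowY t p) - F p‖ ≤ C * |t|) : Continuous F := by
  rw [continuous_iff_continuousAt]
  rintro ⟨x, y, z⟩
  rw [ContinuousAt, tendsto_iff_norm_sub_tendsto_zero]
  have hb : Tendsto (fun q : ℝ × ℝ × ℝ => C * |q.1 - x| + C * |q.2.1 - y|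
      + 4 * C * √|q.2.2 - (z + (q.2.1 - y) * q.1)|) (𝓝 (x, y, z)) (𝓝 0) := by
    have : Continuous (fun q : ℝ × ℝ × ℝ => C * |q.1 - x| + C * |q.2.1 - y|
      + 4 * C * √|q.2.2 - (z + (q.2.1 - y) * q.1)|) := by fun_prop
    simpa using this.tendsto (x, y, z)
  refine squeeze_zero (fun _ => norm_nonneg _) ?_ hb
  rintro ⟨x', y', z'⟩
  have h1 := hX (x' - x) (x, y, z)
  have h2 := hY (y' - y) (x', y, z)
  have h3 := norm_sub_vertical_le hX hY x' y' (z + (y' - y) * x') (z' - (z + (y' - y) * x'))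
  simp only [flowX, flowY, add_sub_cancel] at h1 h2 h3
  rw [show F (x', y', z') - F (x, y, z) = (F (x', y, z) - F (x, y, z))
    + (F (x', y', z + (y' - y) * x') - F (x', y, z))
    + (F (x', y', z') - F (x', y', z + (y' - y) * x')) by abel]
  exact norm_add₃_le.trans (by simp only; linarith)

/-- A map from `ℝ³` to a finite-dimensional space that is Lipschitz along the flows of `∂_x` and
`∂_y + x ∂_z` cannot expand the `z`-direction like the square root. -/
theorem false_of_lipschitz_along_flows_of_vertical_lower_bound [NormedSpace ℝ E]
    [FiniteDimensional ℝ E]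
    (hX : ∀ t p, ‖F (flowX t p) - F p‖ ≤ C * |t|)
    (hY : ∀ t p, ‖F (flowY t p) - F p‖ ≤ C * |t|) {c : ℝ} (hc : 0 < c)
    (hZ : ∀ t > 0, ∀ x y z, c * t ≤ ‖F (x, y, z + t ^ 2) - F (x, y, z)‖) : False := by
  have : ProperSpace E := FiniteDimensional.proper ℝ E
  have hF : Continuous F := continuous_of_lipschitz_along_flows hX hY
  set u : ℕ → ℝ := fun k => 1 / ((k : ℝ) + 1) with hu
  have hu0 : ∀ k, 0 < u k := fun k => by positivity
  have hu1 : ∀ k, u k ≤ 1 := fun k => by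
    rw [hu]; simp only
    rw [div_le_one (by positivity)]; linarith [(Nat.cast_nonneg k : (0 : ℝ) ≤ k)]
  have hulim : Tendsto u atTop (𝓝 0) := tendsto_one_div_add_atTop_nhds_zero_nat
  have hku : ∀ k : ℕ, ((k : ℝ) + 1) * u k = 1 := fun k => by
    rw [hu]; field_simp
  have hmX : ∀ t, Continuous (flowX t) := fun t => by unfold flowX; fun_prop
  have hmY : ∀ t, Continuous (flowY t) := fun t => by unfold flowY; fun_prop
  set A : ℕ → ℝ × ℝ × ℝ → E := fun k p => ((k : ℝ) + 1) • (F (flowX (u k) p) - F p) with hA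
  set B : ℕ → ℝ × ℝ × ℝ → E := fun k p => ((k : ℝ) + 1) • (F (flowY (u k) p) - F p) with hB
  have hAc : ∀ k, Continuous (A k) := fun k =>
    ((hF.comp (hmX _)).sub hF).const_smul _
  have hBc : ∀ k, Continuous (B k) := fun k =>
    ((hF.comp (hmY _)).sub hF).const_smul _
  have hbd : ∀ (k : ℕ) (v : E), ‖v‖ ≤ C * |u k| → ‖((k : ℝ) + 1) • v‖ₑ ≤ C := by
    intro k v hv
    rw [enorm_le_coe, ← NNReal.coe_le_coe, coe_nnnorm, norm_smul, Real.norm_of_nonneg (by positivity)]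
    rw [abs_of_pos (hu0 k)] at hv
    calc ((k : ℝ) + 1) * ‖v‖ ≤ ((k : ℝ) + 1) * (C * u k) := by gcongr
      _ = C * (((k : ℝ) + 1) * u k) := by ring
      _ = C := by rw [hku, mul_one]
  have hAb : ∀ k p, ‖A k p‖ₑ ≤ C := fun k p => hbd k _ (hX _ _)
  have hBb : ∀ k p, ‖B k p‖ₑ ≤ C := fun k p => hbd k _ (hY _ _)
  have hAlim : ∀ᵐ p, ∃ l, Tendsto (fun k => A k p) atTop (𝓝 l) :=
    ae_exists_tendsto_flow_quotient (φ := flowX) continuous_flowX.measurable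
      (fun s t p => by simp [flowX, add_assoc]) (fun p => by simp [flowX])
      measurePreserving_flowX hF hX
  have hBlim : ∀ᵐ p, ∃ l, Tendsto (fun k => B k p) atTop (𝓝 l) :=
    ae_exists_tendsto_flow_quotient (φ := flowY) continuous_flowY.measurable
      (fun s t p => by simp [flowY, add_assoc, add_mul]) (fun p => by simp [flowY])
      measurePreserving_flowY hF hY
  set θ₁ : ℕ → ℝ × ℝ × ℝ → ℝ × ℝ × ℝ := fun k => flowX (u k) with hθ₁
  set θ₃ : ℕ → ℝ × ℝ × ℝ → ℝ × ℝ × ℝ :=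
    fun k => flowX (-u k) ∘ flowY (u k) ∘ flowX (u k) with hθ₃
  set θ₄ : ℕ → ℝ × ℝ × ℝ → ℝ × ℝ × ℝ := fun k => flowY (-u k) ∘ θ₃ k with hθ₄
  have hm₁ : ∀ k, MeasurePreserving (θ₁ k) volume volume := fun k => measurePreserving_flowX _
  have hm₃ : ∀ k, MeasurePreserving (θ₃ k) volume volume := fun k =>
    (measurePreserving_flowX _).comp ((measurePreserving_flowY _).comp (measurePreserving_flowX _))
  have hm₄ : ∀ k, MeasurePreserving (θ₄ k) volume volume := fun k =>
    (measurePreserving_flowY _).comp (hm₃ k)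
  have hlim : ∀ {θ : ℝ → ℝ × ℝ × ℝ → ℝ × ℝ × ℝ}, (∀ p, Continuous fun t => θ t p) →
      (∀ p, θ 0 p = p) → ∀ p, Tendsto (fun k => θ (u k) p) atTop (𝓝 p) := by
    intro θ h h0 p
    have := ((h p).tendsto 0).comp hulim
    rwa [h0] at this
  have hl₁ : ∀ p, Tendsto (fun k => θ₁ k p) atTop (𝓝 p) :=
    hlim (θ := flowX) (fun p => by unfold flowX; fun_prop) (fun p => by simp [flowX])
  have hl₃ : ∀ p, Tendsto (fun k => θ₃ k p) atTop (𝓝 p) :=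
    hlim (θ := fun t => flowX (-t) ∘ flowY t ∘ flowX t)
      (fun p => by simp only [Function.comp_apply, flowX, flowY]; fun_prop)
      (fun p => by simp [flowX, flowY])
  have hl₄ : ∀ p, Tendsto (fun k => θ₄ k p) atTop (𝓝 p) :=
    hlim (θ := fun t => flowY (-t) ∘ flowX (-t) ∘ flowY t ∘ flowX t)
      (fun p => by simp only [Function.comp_apply, flowX, flowY]; fun_prop)
      (fun p => by simp [flowX, flowY])
  set Q : Set (ℝ × ℝ × ℝ) := Icc (-1) 1 ×ˢ Icc (-1) 1 ×ˢ Icc (-1) 1 with hQ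
  set Q' : Set (ℝ × ℝ × ℝ) := Icc (-3) 3 ×ˢ Icc (-3) 3 ×ˢ Icc (-3) 3 with hQ'
  have hQ'c : IsCompact Q' := isCompact_Icc.prod (isCompact_Icc.prod isCompact_Icc)
  have hQQ' : Q ⊆ Q' := by
    have : Icc (-1 : ℝ) 1 ⊆ Icc (-3) 3 := Icc_subset_Icc (by norm_num) (by norm_num)
    exact prod_mono this (prod_mono this this)
  have hQpos : volume Q ≠ 0 := by
    rw [hQ, Measure.volume_eq_prod, Measure.prod_prod, Measure.volume_eq_prod, Measure.prod_prod,
      Real.volume_Icc]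
    norm_num
  have hQfin : volume Q ≠ ∞ :=
    ne_top_of_le_ne_top hQ'c.measure_lt_top.ne (measure_mono hQQ')
  have hmaps : ∀ k, MapsTo (θ₁ k) Q Q' ∧ MapsTo (θ₃ k) Q Q' ∧ MapsTo (θ₄ k) Q Q' := by
    intro k
    have h0 := hu0 k
    have h1 := hu1 k
    refine ⟨?_, ?_, ?_⟩ <;> rintro ⟨x, y, z⟩ ⟨⟨hx, hx'⟩, ⟨hy, hy'⟩, hz, hz'⟩ <;>
      simp only [hθ₁, hθ₃, hθ₄, hQ', Function.comp_apply, flowX, flowY, mem_prod, mem_Icc] at * <;>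
      refine ⟨⟨?_, ?_⟩, ⟨?_, ?_⟩, ?_, ?_⟩ <;> nlinarith
  have t₁ := tendsto_lintegral_enorm_sub_comp hBc hBb hBlim hm₁ hl₁ hQ'c.measurableSet hQQ'
    hQ'c.measure_lt_top.ne fun k => (hmaps k).1
  have t₃ := tendsto_lintegral_enorm_sub_comp hAc hAb hAlim hm₃ hl₃ hQ'c.measurableSet hQQ'
    hQ'c.measure_lt_top.ne fun k => (hmaps k).2.1
  have t₄ := tendsto_lintegral_enorm_sub_comp hBc hBb hBlim hm₄ hl₄ hQ'c.measurableSet hQQ'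
    hQ'c.measure_lt_top.ne fun k => (hmaps k).2.2
  have hlow : ∀ k p, ENNReal.ofReal c ≤
      ‖A k p - A k (θ₃ k p)‖ₑ + ‖B k p - B k (θ₁ k p)‖ₑ + ‖B k p - B k (θ₄ k p)‖ₑ := by
    rintro k ⟨x, y, z⟩
    have e3 : θ₃ k (x, y, z) = (x, y + u k, z + u k * (x + u k)) := by
      simp [hθ₃, flowX, flowY]
    have e4 : θ₄ k (x, y, z) = (x, y, z + u k ^ 2) := by
      simp only [hθ₄, Function.comp_apply, e3, flowY]
      ext <;> simp only <;> ring
    have hsum : ((k : ℝ) + 1) • (F (x, y, z + u k ^ 2) - F (x, y, z)) =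
        (A k (x, y, z) - A k (θ₃ k (x, y, z)))
        - (B k (x, y, z) - B k (θ₁ k (x, y, z)))
        + (B k (x, y, z) - B k (θ₄ k (x, y, z))) := by
      rw [e3, e4]
      simp only [hA, hB, hθ₁, ← smul_sub, ← smul_add]
      simp only [flowX, flowY]
      rw [show z + u k ^ 2 + u k * x = z + u k * (x + u k) by ring]
      congr 1
      abel
    have hge : c ≤ ‖((k : ℝ) + 1) • (F (x, y, z + u k ^ 2) - F (x, y, z))‖ := by
      rw [norm_smul, Real.norm_of_nonneg (by positivity)]
      calc c = ((k : ℝ) + 1) * (c * u k) := by rw [mul_left_comm, hku, mul_one]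
        _ ≤ _ := by gcongr; exact hZ _ (hu0 k) _ _ _
    calc ENNReal.ofReal c ≤ ‖((k : ℝ) + 1) • (F (x, y, z + u k ^ 2) - F (x, y, z))‖ₑ := by
          rw [← ofReal_norm]; exact ENNReal.ofReal_le_ofReal hge
      _ ≤ _ := by
          rw [hsum]
          refine (enorm_add_le _ _).trans ?_
          gcongr
          exact enorm_sub_le
  have hintg : ∀ k, ENNReal.ofReal c * volume Q ≤ (∫⁻ p in Q, ‖A k p - A k (θ₃ k p)‖ₑ)
      + (∫⁻ p in Q, ‖B k p - B k (θ₁ k p)‖ₑ) + ∫⁻ p in Q, ‖B k p - B k (θ₄ k p)‖ₑ := by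
    intro k
    borelize E
    rw [← lintegral_add_right, ← lintegral_add_right, ← setLIntegral_const]
    · exact lintegral_mono (hlow k)
    · exact ((hBc k).measurable.sub ((hBc k).measurable.comp (hm₄ k).measurable)).enorm
    · exact ((hBc k).measurable.sub ((hBc k).measurable.comp (hm₁ k).measurable)).enorm
  have h0 : ENNReal.ofReal c * volume Q ≤ 0 :=
    ge_of_tendsto' (by simpa using (t₃.add t₁).add t₄) hintg
  rw [nonpos_iff_eq_zero, mul_eq_zero, ENNReal.ofReal_eq_zero] at h0
  exact h0.elim (fun h => absurd h hc.not_ge) hQpos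

end ModelCoordinates

section BlowUp

/-- The anisotropic dilatation of `ℝ³` compatible with `flowX` and `flowY`. -/
def dilation (ε : ℝ) (p : ℝ × ℝ × ℝ) : ℝ × ℝ × ℝ := (ε * p.1, ε * p.2.1, ε ^ 2 * p.2.2)

/-- Local version of `false_of_lipschitz_along_flows_of_vertical_lower_bound`, obtained from it by
blowing up at the origin along an ultrafilter. -/
theorem false_of_local_lipschitz_along_flows_of_vertical_lower_bound {E : Type*}
    [NormedAddCommGroup E] [NormedSpace ℝ E] [FiniteDimensional ℝ E] {V : Set (ℝ × ℝ × ℝ)}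
    {g : ℝ × ℝ × ℝ → E} {C : ℝ≥0}
    (hV : ∀ p, ∃ K, ∀ᶠ ε in 𝓝[>] (0 : ℝ), dilation ε p ∈ V ∧ ‖g (dilation ε p) - g 0‖ ≤ K * ε)
    (hX : ∀ t p, p ∈ V → flowX t p ∈ V → ‖g (flowX t p) - g p‖ ≤ C * |t|)
    (hY : ∀ t p, p ∈ V → flowY t p ∈ V → ‖g (flowY t p) - g p‖ ≤ C * |t|)
    {c : ℝ} (hc : 0 < c)
    (hZ : ∀ t > 0, ∀ x y z, (x, y, z) ∈ V → (x, y, z + t ^ 2) ∈ V →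
      c * t ≤ ‖g (x, y, z + t ^ 2) - g (x, y, z)‖) : False := by
  have : ProperSpace E := FiniteDimensional.proper ℝ E
  let 𝒰 : Ultrafilter ℝ := Ultrafilter.of (𝓝[>] 0)
  have h𝒰 : (𝒰 : Filter ℝ) ≤ 𝓝[>] 0 := Ultrafilter.of_le _
  have hpos : ∀ᶠ ε in (𝒰 : Filter ℝ), 0 < ε := h𝒰 self_mem_nhdsWithin
  have hlim : ∀ p, ∃ l, Tendsto (fun ε : ℝ => ε⁻¹ • (g (dilation ε p) - g 0)) 𝒰 (𝓝 l) := by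
    intro p
    obtain ⟨K, hK⟩ := hV p
    obtain ⟨l, -, hl⟩ := (isCompact_closedBall (0 : E) K).ultrafilter_le_nhds'
      (𝒰.map fun ε : ℝ => ε⁻¹ • (g (dilation ε p) - g 0)) (by
        rw [Ultrafilter.mem_map]
        filter_upwards [h𝒰 hK, hpos] with ε h1 h2
        rw [mem_preimage, mem_closedBall_zero_iff, norm_smul, norm_inv, Real.norm_of_nonneg h2.le,
          inv_mul_le_iff₀ h2, mul_comm]
        exact h1.2)
    exact ⟨l, hl⟩
  choose F hF using hlim
  have hsub : ∀ p q, Tendsto (fun ε : ℝ => ε⁻¹ * ‖g (dilation ε q) - g (dilation ε p)‖) 𝒰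
      (𝓝 ‖F q - F p‖) := by
    intro p q
    refine ((hF q).sub (hF p)).norm.congr' ?_
    filter_upwards [hpos] with ε hε
    rw [← smul_sub, norm_smul, norm_inv, Real.norm_of_nonneg hε.le, sub_sub_sub_cancel_right]
  have hmem : ∀ p, ∀ᶠ ε in (𝒰 : Filter ℝ), dilation ε p ∈ V := fun p => by
    obtain ⟨K, hK⟩ := hV p
    exact (hK.filter_mono h𝒰).mono fun _ h => h.1
  refine false_of_lipschitz_along_flows_of_vertical_lower_bound (F := F) (C := C) ?_ ?_ hc ?_
  · intro t p
    refine le_of_tendsto (hsub p (flowX t p)) ?_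
    filter_upwards [hpos, hmem p, hmem (flowX t p)] with ε hε h1 h2
    have e : dilation ε (flowX t p) = flowX (ε * t) (dilation ε p) := by
      ext <;> simp only [dilation, flowX] <;> ring
    rw [e] at h2 ⊢
    rw [inv_mul_le_iff₀ hε]
    refine (hX _ _ h1 h2).trans_eq ?_
    rw [abs_mul, abs_of_pos hε]; ring
  · intro t p
    refine le_of_tendsto (hsub p (flowY t p)) ?_
    filter_upwards [hpos, hmem p, hmem (flowY t p)] with ε hε h1 h2
    have e : dilation ε (flowY t p) = flowY (ε * t) (dilation ε p) := by
      ext <;> simp only [dilation, flowY] <;> ring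
    rw [e] at h2 ⊢
    rw [inv_mul_le_iff₀ hε]
    refine (hY _ _ h1 h2).trans_eq ?_
    rw [abs_mul, abs_of_pos hε]; ring
  · intro t ht x y z
    refine ge_of_tendsto (hsub (x, y, z) (x, y, z + t ^ 2)) ?_
    filter_upwards [hpos, hmem (x, y, z), hmem (x, y, z + t ^ 2)] with ε hε h1 h2
    have e : dilation ε (x, y, z + t ^ 2) = (ε * x, ε * y, ε ^ 2 * z + (ε * t) ^ 2) := by
      ext <;> simp only [dilation]; ring
    rw [e] at h2 ⊢
    rw [le_inv_mul_iff₀ hε]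
    refine le_trans (le_of_eq ?_) (hZ (ε * t) (by positivity) _ _ _ h1 h2)
    ring

end BlowUp

section SymplecticForm

variable {n : ℕ}

theorem omegaForm_add_right (x y z : Epl n) :
    omegaForm x (y + z) = omegaForm x y + omegaForm x z := by
  simp only [omegaForm, PiLp.add_apply, ← Finset.sum_add_distrib]
  exact Finset.sum_congr rfl fun i _ => by ring

theorem omegaForm_smul_right (x : Epl n) (a : ℝ) (y : Epl n) :
    omegaForm x (a • y) = a * omegaForm x y := by
  simp only [omegaForm, PiLp.smul_apply, smul_eq_mul, Finset.mul_sum]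
  exact Finset.sum_congr rfl fun i _ => by ring

theorem omegaForm_swap (x y : Epl n) : omegaForm x y = -omegaForm y x := by
  simp only [omegaForm, ← Finset.sum_neg_distrib]
  exact Finset.sum_congr rfl fun i _ => by ring

theorem omegaForm_add_left (x y z : Epl n) :
    omegaForm (x + y) z = omegaForm x z + omegaForm y z := by
  rw [omegaForm_swap, omegaForm_add_right, omegaForm_swap z x, omegaForm_swap z y]; ring

theorem omegaForm_smul_left (a : ℝ) (x y : Epl n) :
    omegaForm (a • x) y = a * omegaForm x y := by
  rw [omegaForm_swap, omegaForm_smul_right, omegaForm_swap y x]; ring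

theorem omegaForm_self (x : Epl n) : omegaForm x x = 0 := by
  have := omegaForm_swap x x; linarith

/-- The symplectic form with its first argument fixed, as a continuous linear map. -/
def omegaCLM (x : Epl n) : Epl n →L[ℝ] ℝ :=
  LinearMap.toContinuousLinearMap
    { toFun := omegaForm x
      map_add' := omegaForm_add_right x
      map_smul' := fun a y => omegaForm_smul_right x a y }

theorem omegaCLM_apply (x y : Epl n) : omegaCLM x y = omegaForm x y := rfl

theorem abs_omegaForm_le (x y : Epl n) : |omegaForm x y| ≤ 2 * n * (‖x‖ * ‖y‖) := by
  have hc : ∀ i j, |x i * y j| ≤ ‖x‖ * ‖y‖ := fun i j => by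
    rw [abs_mul]
    exact mul_le_mul (PiLp.norm_apply_le x i) (PiLp.norm_apply_le y j) (abs_nonneg _)
      (norm_nonneg _)
  calc |omegaForm x y| ≤ ∑ i : Fin n, |x (idxA i) * y (idxB i) - x (idxB i) * y (idxA i)| :=
        Finset.abs_sum_le_sum_abs _ _
    _ ≤ ∑ _i : Fin n, 2 * (‖x‖ * ‖y‖) := by
        refine Finset.sum_le_sum fun i _ => (abs_sub _ _).trans ?_
        linarith [hc (idxA i) (idxB i), hc (idxB i) (idxA i)]
    _ = 2 * n * (‖x‖ * ‖y‖) := by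
        rw [Finset.sum_const, Finset.card_univ, Fintype.card_fin, nsmul_eq_mul]; ring

/-- The first vector of the standard symplectic basis. -/
def basisA (hn : 1 ≤ n) : Epl n := EuclideanSpace.single (idxA ⟨0, hn⟩) 1

/-- The symplectic conjugate of `basisA`. -/
def basisB (hn : 1 ≤ n) : Epl n := EuclideanSpace.single (idxB ⟨0, hn⟩) 1

theorem norm_basisA (hn : 1 ≤ n) : ‖basisA hn‖ = 1 := by simp [basisA]

theorem norm_basisB (hn : 1 ≤ n) : ‖basisB hn‖ = 1 := by simp [basisB]

theorem omegaForm_basisA_basisB (hn : 1 ≤ n) : omegaForm (basisA hn) (basisB hn) = 1 := by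
  have h1 : ∀ i j : Fin n, idxA i ≠ idxB j := fun i j h => by
    have := congrArg Fin.val h
    simp only [idxA, idxB] at this
    have := i.isLt
    omega
  rw [omegaForm, Finset.sum_eq_single (⟨0, hn⟩ : Fin n)]
  · simp [basisA, basisB, (h1 _ _).symm]
  · intro i _ hi
    have h2 : idxA i ≠ idxA ⟨0, hn⟩ := fun h => hi (Fin.ext (by simpa [idxA] using h))
    simp [basisA, basisB, h2, (h1 _ _).symm]
  · simp

end SymplecticForm

section CarnotCaratheodory

variable {n : ℕ}

/-- `L` is the length of some horizontal Lipschitz curve from `p` to `q`. -/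
def IsHorizontalLength (p q : Hpt n) (L : ℝ) : Prop :=
  ∃ (γ : ℝ → Epl n) (γb : ℝ → ℝ) (γ' : ℝ → Epl n) (K : NNReal),
    LipschitzOnWith K (fun t => ((γ t, γb t) : Hpt n)) (Set.Icc 0 1) ∧
    (γ 0, γb 0) = p ∧ (γ 1, γb 1) = q ∧ IsHorizontalLift γ γb γ' ∧
    L = ∫ t in (0 : ℝ)..1, ‖γ' t‖

theorem IsHorizontalLength.nonneg {p q : Hpt n} {L : ℝ} (h : IsHorizontalLength p q L) :
    0 ≤ L := by
  obtain ⟨γ, γb, γ', K, -, -, -, -, rfl⟩ := h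
  exact intervalIntegral.integral_nonneg zero_le_one fun _ _ => norm_nonneg _

theorem ccDist_le {p q : Hpt n} {L : ℝ} (h : IsHorizontalLength p q L) : ccDist n p q ≤ L :=
  csInf_le ⟨0, fun _ hL => IsHorizontalLength.nonneg hL⟩ h

theorem le_ccDist {p q : Hpt n} {L₀ a : ℝ} (h₀ : IsHorizontalLength p q L₀)
    (ha : ∀ L, IsHorizontalLength p q L → a ≤ L) : a ≤ ccDist n p q :=
  le_csInf ⟨L₀, h₀⟩ ha

theorem abs_sub_le_integral_of_lipschitzOnWith {u b : ℝ → ℝ} {K : ℝ≥0}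
    (hu : LipschitzOnWith K u (Icc 0 1)) (hb : IntervalIntegrable b volume 0 1)
    (hb0 : ∀ t, 0 ≤ b t) {u' : ℝ → ℝ}
    (hd : ∀ᵐ t ∂(volume.restrict (Icc (0 : ℝ) 1)), HasDerivAt u (u' t) t ∧ |u' t| ≤ b t)
    {s : ℝ} (hs : s ∈ Icc (0 : ℝ) 1) : |u s - u 0| ≤ ∫ t in (0 : ℝ)..1, b t := by
  have hsub : uIcc 0 s ⊆ Icc (0 : ℝ) 1 := by
    rw [uIcc_of_le hs.1]; exact Icc_subset_Icc_right hs.2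
  rw [← (hu.mono hsub).absolutelyContinuousOnInterval.integral_deriv_eq_sub]
  have hbs : IntervalIntegrable b volume 0 s := hb.mono_set (by
    rw [uIcc_of_le zero_le_one]; exact hsub)
  rw [ae_restrict_iff' measurableSet_Icc] at hd
  calc |∫ t in (0 : ℝ)..s, deriv u t| ≤ ∫ t in (0 : ℝ)..s, b t := by
        rw [← Real.norm_eq_abs]
        refine intervalIntegral.norm_integral_le_of_norm_le hs.1 ?_ hbs
        filter_upwards [hd] with t ht hts
        obtain ⟨h1, h2⟩ := ht ⟨hts.1.le, hts.2.trans hs.2⟩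
        rwa [h1.deriv, Real.norm_eq_abs]
    _ ≤ ∫ t in (0 : ℝ)..1, b t := intervalIntegral.integral_mono_interval le_rfl hs.1 hs.2
        (Eventually.of_forall hb0) hb

/-- A horizontal curve whose horizontal projection is closed has height difference bounded by the
square of its length. -/
theorem IsHorizontalLength.abs_sub_le {p q : Hpt n} {L : ℝ} (h : IsHorizontalLength p q L)
    (hpq : p.1 = q.1) : |q.2 - p.2| ≤ n * L ^ 2 := by
  obtain ⟨γ, γb, γ', K, hlip, rfl, rfl, hlift, hL⟩ := h
  simp only at hpq ⊢
  have hintg : IntervalIntegrable (fun t => ‖γ' t‖) volume 0 1 := by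
    rw [intervalIntegrable_iff_integrableOn_Ioo_of_le zero_le_one]
    have hlift' := ae_restrict_of_ae_restrict_of_subset Ioo_subset_Icc_self hlift
    have hγ : LipschitzOnWith (1 * K) γ (Icc 0 1) := LipschitzWith.prod_fst.comp_lipschitzOnWith hlip
    have hintg' : IntegrableOn (deriv γ) (Ioo 0 1) :=
      Measure.integrableOn_of_bounded (M := (1 * K : ℝ≥0)) (by simp)
        (stronglyMeasurable_deriv γ).aestronglyMeasurable
        (by
          filter_upwards [ae_restrict_mem measurableSet_Ioo] with t ht
          exact norm_deriv_le_of_lipschitzOn (Icc_mem_nhds ht.1 ht.2) hγ)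
    refine hintg'.norm.congr ?_
    filter_upwards [hlift'] with t ht
    rw [ht.1.deriv]
  have hdist : ∀ s ∈ Icc (0 : ℝ) 1, ‖γ s - γ 0‖ ≤ L := by
    intro s hs
    set w := γ s - γ 0 with hw
    have h1 : |inner ℝ w (γ s) - inner ℝ w (γ 0)| ≤ ∫ t in (0 : ℝ)..1, ‖w‖ * ‖γ' t‖ := by
      let ℓ : Hpt n →L[ℝ] ℝ := (innerSL ℝ w).comp (ContinuousLinearMap.fst ℝ (Epl n) ℝ)
      refine abs_sub_le_integral_of_lipschitzOnWith (u := fun t => inner ℝ w (γ t))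
        (u' := fun t => inner ℝ w (γ' t))
        (ℓ.lipschitz.comp_lipschitzOnWith hlip) (hintg.const_mul _) (fun t => by positivity) ?_ hs
      filter_upwards [hlift] with t ht
      exact ⟨(innerSL ℝ w).hasFDerivAt.comp_hasDerivAt t ht.1, abs_real_inner_le_norm _ _⟩
    rw [← inner_sub_right, ← hw, real_inner_self_eq_norm_sq, abs_of_nonneg (sq_nonneg _),
      intervalIntegral.integral_const_mul, ← hL, sq] at h1
    rcases eq_or_lt_of_le (norm_nonneg w) with h0 | h0
    · rw [← h0, hL]
      exact intervalIntegral.integral_nonneg zero_le_one fun _ _ => norm_nonneg _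
    · exact le_of_mul_le_mul_left h1 h0
  let ℓ : Hpt n →L[ℝ] ℝ := ContinuousLinearMap.snd ℝ (Epl n) ℝ -
    ((1 / 2 : ℝ) • omegaCLM (γ 0)).comp (ContinuousLinearMap.fst ℝ (Epl n) ℝ)
  have hmain := abs_sub_le_integral_of_lipschitzOnWith
    (u := fun t => γb t - 1 / 2 * omegaForm (γ 0) (γ t)) (b := fun t => n * L * ‖γ' t‖)
    (u' := fun t => 1 / 2 * omegaForm (γ t) (γ' t) - 1 / 2 * omegaForm (γ 0) (γ' t))
    (s := 1)
    (ℓ.lipschitz.comp_lipschitzOnWith hlip) (hintg.const_mul _)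
    (fun t => by
      have : 0 ≤ L := (norm_nonneg _).trans (hdist 0 (by simp))
      positivity)
    (by
      filter_upwards [hlift, ae_restrict_mem measurableSet_Icc] with t ht hmem
      refine ⟨ht.2.sub (((omegaCLM (γ 0)).hasFDerivAt.comp_hasDerivAt t ht.1).const_mul _), ?_⟩
      have e : 1 / 2 * omegaForm (γ t) (γ' t) - 1 / 2 * omegaForm (γ 0) (γ' t)
          = 1 / 2 * omegaForm (γ t - γ 0) (γ' t) := by
        have := omegaForm_add_left (γ t - γ 0) (γ 0) (γ' t)
        rw [sub_add_cancel] at this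
        rw [this]; ring
      rw [e, abs_mul, abs_of_pos (by norm_num : (0 : ℝ) < 1 / 2)]
      have h2 := abs_omegaForm_le (γ t - γ 0) (γ' t)
      have h3 : ‖γ t - γ 0‖ * ‖γ' t‖ ≤ L * ‖γ' t‖ := by gcongr; exact hdist t hmem
      have h4 : (n : ℝ) * (‖γ t - γ 0‖ * ‖γ' t‖) ≤ n * (L * ‖γ' t‖) := by gcongr
      linarith)
    (by simp)
  rw [intervalIntegral.integral_const_mul, ← hL, ← hpq] at hmain
  simp only [sub_sub_sub_cancel_right] at hmain
  calc _ ≤ _ := hmain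
    _ = _ := by ring

/-- Coordinates on a left coset of a copy of `H(1)` inside `H(n)`, in which the two horizontal
generators become `∂_x` and `∂_y + x ∂_z`. -/
def cosetChart (hn : 1 ≤ n) (p : Hpt n) (a : ℝ × ℝ × ℝ) : Hpt n :=
  hMul p (a.1 • basisA hn + a.2.1 • basisB hn, a.2.2 - 1 / 2 * (a.1 * a.2.1))

theorem cosetChart_zero (hn : 1 ≤ n) (p : Hpt n) : cosetChart hn p 0 = p := by
  have : omegaForm p.1 0 = 0 := (omegaCLM p.1).map_zero
  simp [cosetChart, hMul, this]

/-- A curve tangent to the span of `∂_x` and `∂_y + x ∂_z` is horizontal in the coset chart. -/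
theorem isHorizontalLength_cosetChart (hn : 1 ≤ n) (p : Hpt n) {P Q Z P' Q' : ℝ → ℝ}
    (hP : ∀ t, HasDerivAt P (P' t) t) (hQ : ∀ t, HasDerivAt Q (Q' t) t)
    (hZ : ∀ t, HasDerivAt Z (P t * Q' t) t) (hP' : Continuous P') (hQ' : Continuous Q') :
    IsHorizontalLength (cosetChart hn p (P 0, Q 0, Z 0)) (cosetChart hn p (P 1, Q 1, Z 1))
      (∫ t in (0 : ℝ)..1, ‖P' t • basisA hn + Q' t • basisB hn‖) := by
  have hPc : Continuous P := continuous_iff_continuousAt.2 fun t => (hP t).continuousAt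
  have hQc : Continuous Q := continuous_iff_continuousAt.2 fun t => (hQ t).continuousAt
  set v : ℝ → Epl n := fun t => P' t • basisA hn + Q' t • basisB hn with hv
  set h : ℝ → ℝ := fun t => 1 / 2 * (P t * Q' t - P' t * Q t) + 1 / 2 * omegaForm p.1 (v t) with hh
  have hd1 : ∀ t, HasDerivAt (fun t => (cosetChart hn p (P t, Q t, Z t)).1) (v t) t := fun t =>
    (((hP t).smul_const (basisA hn)).add ((hQ t).smul_const (basisB hn))).const_add p.1
  have hd2 : ∀ t, HasDerivAt (fun t => (cosetChart hn p (P t, Q t, Z t)).2) (h t) t := by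
    intro t
    have h1 := (omegaCLM p.1).hasFDerivAt.comp_hasDerivAt t
      (((hP t).smul_const (basisA hn)).add ((hQ t).smul_const (basisB hn)))
    have h2 := (((hZ t).sub (((hP t).mul (hQ t)).const_mul (1 / 2))).const_add p.2).add
      (h1.const_mul (1 / 2))
    refine h2.congr_deriv ?_
    simp only [hh, hv, omegaCLM_apply]
    ring
  have hvc : Continuous v := by fun_prop
  have hhc : Continuous h := by
    have : Continuous fun t => omegaForm p.1 (v t) := (omegaCLM p.1).continuous.comp hvc
    fun_prop
  obtain ⟨K, hK⟩ := (isCompact_Icc (a := (0 : ℝ)) (b := 1)).exists_bound_of_continuousOn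
    (hvc.prodMk hhc).continuousOn
  refine ⟨fun t => (cosetChart hn p (P t, Q t, Z t)).1,
    fun t => (cosetChart hn p (P t, Q t, Z t)).2, v, K.toNNReal, ?_, rfl, rfl, ?_, rfl⟩
  · refine (convex_Icc 0 1).lipschitzOnWith_of_nnnorm_hasDerivWithin_le
      (fun t _ => ((hd1 t).prodMk (hd2 t)).hasDerivWithinAt) fun t ht => ?_
    rw [← NNReal.coe_le_coe, coe_nnnorm]
    exact (hK t ht).trans (Real.le_coe_toNNReal K)
  · refine Eventually.of_forall fun t => ⟨hd1 t, (hd2 t).congr_deriv ?_⟩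
    simp only [cosetChart, hMul, hh, hv, omegaForm_add_left, omegaForm_add_right,
      omegaForm_smul_left, omegaForm_smul_right, omegaForm_self, omegaForm_basisA_basisB,
      omegaForm_swap (basisB hn) (basisA hn)]
    ring

theorem ccDist_cosetChart_flowX_le (hn : 1 ≤ n) (p : Hpt n) (t : ℝ) (a : ℝ × ℝ × ℝ) :
    ccDist n (cosetChart hn p (flowX t a)) (cosetChart hn p a) ≤ |t| := by
  have := ccDist_le (isHorizontalLength_cosetChart hn p (P := fun s => a.1 + t + s * -t)
    (Q := fun _ => a.2.1) (Z := fun _ => a.2.2) (P' := fun _ => -t) (Q' := fun _ => 0)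
    (fun s => by simpa using ((hasDerivAt_id s).mul_const (-t)).const_add (a.1 + t))
    (fun s => hasDerivAt_const _ _) (fun s => by simpa using hasDerivAt_const s a.2.2)
    continuous_const continuous_const)
  simpa [flowX, norm_smul, norm_basisA] using this

theorem ccDist_cosetChart_flowY_le (hn : 1 ≤ n) (p : Hpt n) (t : ℝ) (a : ℝ × ℝ × ℝ) :
    ccDist n (cosetChart hn p (flowY t a)) (cosetChart hn p a) ≤ |t| := by
  have := ccDist_le (isHorizontalLength_cosetChart hn p (P := fun _ => a.1)
    (Q := fun s => a.2.1 + t + s * -t) (Z := fun s => a.2.2 + t * a.1 + s * -(t * a.1))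
    (P' := fun _ => 0) (Q' := fun _ => -t) (fun s => hasDerivAt_const _ _)
    (fun s => by simpa using ((hasDerivAt_id s).mul_const (-t)).const_add (a.2.1 + t))
    (fun s => (((hasDerivAt_id s).mul_const (-(t * a.1))).const_add
      (a.2.2 + t * a.1)).congr_deriv (by ring))
    continuous_const continuous_const)
  simpa [flowY, norm_smul, norm_basisB] using this

/-- Every point of `ℝ³` is reached from the origin by a polynomial curve tangent to the span of
`∂_x` and `∂_y + x ∂_z`. -/
theorem exists_tangent_curve (a : ℝ × ℝ × ℝ) : ∃ P Q Z P' Q' : ℝ → ℝ,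
    (∀ t, HasDerivAt P (P' t) t) ∧ (∀ t, HasDerivAt Q (Q' t) t) ∧
    (∀ t, HasDerivAt Z (P t * Q' t) t) ∧ Continuous P' ∧ Continuous Q' ∧
    (P 0, Q 0, Z 0) = 0 ∧ (P 1, Q 1, Z 1) = a := by
  obtain ⟨x, y, z⟩ := a
  set β : ℝ := -70 * (z - x * y / 2) with hβ
  have hd : ∀ (c₁ c₂ c₃ c₄ c₅ c₆ c₇ t : ℝ), HasDerivAt
      (fun t => c₁ * t + c₂ * t ^ 2 + c₃ * t ^ 3 + c₄ * t ^ 4 + c₅ * t ^ 5 + c₆ * t ^ 6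
        + c₇ * t ^ 7)
      (c₁ + 2 * c₂ * t + 3 * c₃ * t ^ 2 + 4 * c₄ * t ^ 3 + 5 * c₅ * t ^ 4 + 6 * c₆ * t ^ 5
        + 7 * c₇ * t ^ 6) t := by
    intro c₁ c₂ c₃ c₄ c₅ c₆ c₇ t
    refine (((((((hasDerivAt_id t).const_mul c₁).add ((hasDerivAt_pow 2 t).const_mul c₂)).add
      ((hasDerivAt_pow 3 t).const_mul c₃)).add ((hasDerivAt_pow 4 t).const_mul c₄)).add
      ((hasDerivAt_pow 5 t).const_mul c₅)).add ((hasDerivAt_pow 6 t).const_mul c₆)).add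
      ((hasDerivAt_pow 7 t).const_mul c₇) |>.congr_deriv ?_
    push_cast
    ring
  refine ⟨_, _, _, _, _, hd (x + 1) (-3) 2 0 0 0 0, hd (y + β) (-6 * β) (10 * β) (-5 * β) 0 0 0,
    fun t => (hd 0 (x * y / 2 + x * β / 2 + y / 2 + β / 2)
      (-4 * x * β - y - 5 * β) (15 / 2 * x * β + y / 2 + 17 * β) (-4 * x * β - 134 / 5 * β)
      (20 * β) (-40 / 7 * β) t).congr_deriv ?_, ?_, ?_, ?_, ?_⟩
  · ring
  · fun_prop
  · fun_prop
  · simp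
  · ext
    · simp only; ring
    · simp only; ring
    · simp only [hβ]; ring

theorem exists_isHorizontalLength_vertical (hn : 1 ≤ n) (p : Hpt n) (x y z s : ℝ) :
    ∃ L, IsHorizontalLength (cosetChart hn p (x, y, z)) (cosetChart hn p (x, y, z + s)) L := by
  obtain ⟨P, Q, Z, P', Q', hP, hQ, hZ, hP', hQ', h0, h1⟩ := exists_tangent_curve (0, 0, s)
  simp only [Prod.mk_eq_zero, Prod.mk.injEq] at h0 h1
  have := isHorizontalLength_cosetChart hn p (P := fun t => x + P t) (Q := fun t => y + Q t)
    (Z := fun t => z + Z t + x * Q t) (fun t => (hP t).const_add x) (fun t => (hQ t).const_add y)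
    (fun t => (((hZ t).const_add z).add ((hQ t).const_mul x)).congr_deriv (by ring)) hP' hQ'
  simp only [h0, h1, add_zero, mul_zero] at this
  exact ⟨_, this⟩

theorem le_ccDist_cosetChart_vertical (hn : 1 ≤ n) (p : Hpt n) {t : ℝ} (ht : 0 < t)
    (x y z : ℝ) :
    t / √n ≤ ccDist n (cosetChart hn p (x, y, z + t ^ 2)) (cosetChart hn p (x, y, z)) := by
  obtain ⟨L₀, hL₀⟩ := exists_isHorizontalLength_vertical hn p x y (z + t ^ 2) (-t ^ 2)
  rw [show z + t ^ 2 + -t ^ 2 = z by ring] at hL₀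
  refine le_ccDist hL₀ fun L hL => ?_
  have hn0 : (0 : ℝ) < n := by exact_mod_cast hn
  have h1 := hL.abs_sub_le rfl
  have h2 : |(cosetChart hn p (x, y, z)).2 - (cosetChart hn p (x, y, z + t ^ 2)).2| = t ^ 2 := by
    have h3 : (cosetChart hn p (x, y, z)).2 - (cosetChart hn p (x, y, z + t ^ 2)).2 = -t ^ 2 := by
      simp only [cosetChart, hMul]
      ring
    rw [h3, abs_neg, abs_of_nonneg (sq_nonneg t)]
  rw [h2] at h1
  rw [div_le_iff₀ (by positivity)]
  refine (sq_le_sq₀ ht.le (mul_nonneg hL.nonneg (Real.sqrt_nonneg _))).1 ?_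
  rw [mul_pow, Real.sq_sqrt hn0.le]
  linarith

/-- Points of the coset chart approach its base point linearly under the dilatations. -/
theorem exists_ccDist_dilation_le (hn : 1 ≤ n) (p : Hpt n) (a : ℝ × ℝ × ℝ) :
    ∃ L, ∀ ε > 0, ccDist n p (cosetChart hn p (dilation ε a)) ≤ ε * L := by
  obtain ⟨P, Q, Z, P', Q', hP, hQ, hZ, hP', hQ', h0, h1⟩ := exists_tangent_curve a
  refine ⟨∫ t in (0 : ℝ)..1, ‖P' t • basisA hn + Q' t • basisB hn‖, fun ε hε => ?_⟩
  have h := ccDist_le (isHorizontalLength_cosetChart hn p (P := fun t => ε * P t)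
    (Q := fun t => ε * Q t) (Z := fun t => ε ^ 2 * Z t) (fun t => (hP t).const_mul ε)
    (fun t => (hQ t).const_mul ε) (fun t => ((hZ t).const_mul (ε ^ 2)).congr_deriv (by ring))
    (hP'.const_mul ε) (hQ'.const_mul ε))
  simp only [Prod.mk_eq_zero] at h0
  have h2 : (ε * P 1, ε * Q 1, ε ^ 2 * Z 1) = dilation ε a := by rw [← h1]; rfl
  have h3 : ((ε * P 0, ε * Q 0, ε ^ 2 * Z 0) : ℝ × ℝ × ℝ) = 0 := by simp [h0]
  rw [h2, h3, cosetChart_zero] at h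
  refine h.trans_eq ?_
  rw [← intervalIntegral.integral_const_mul]
  refine intervalIntegral.integral_congr fun t _ => ?_
  simp only [mul_smul]
  rw [← smul_add, norm_smul, Real.norm_of_nonneg hε.le]

end CarnotCaratheodory

/-- Rigidity / pure unrectifiability of the Heisenberg group: there is no
bi-Lipschitz map from a nonempty subset of `H(n)` which is open for the
Carnot–Carathéodory topology into a Euclidean space `ℝ^m`. -/
theorem heisenberg_purely_unrectifiable (n m : ℕ) (hn : 1 ≤ n) (hm : 1 ≤ m)
    (U : Set (Hpt n)) (hne : U.Nonempty)
    (hopen : ∀ p ∈ U, ∃ r : ℝ, 0 < r ∧ ∀ q : Hpt n, ccDist n p q < r → q ∈ U)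
    (f : Hpt n → EuclideanSpace ℝ (Fin m)) (c C : ℝ) (hc : 0 < c) (hC : c ≤ C) :
    ¬ (∀ p ∈ U, ∀ q ∈ U,
        c * ccDist n p q ≤ ‖f p - f q‖ ∧ ‖f p - f q‖ ≤ C * ccDist n p q) := by
  intro hbi
  obtain ⟨p₀, hp₀⟩ := hne
  have hC0 : 0 < C := hc.trans_le hC
  have hCn : ((C.toNNReal : ℝ≥0) : ℝ) = C := Real.coe_toNNReal C hC0.le
  have hn0 : (0 : ℝ) < n := by exact_mod_cast hn
  refine false_of_local_lipschitz_along_flows_of_vertical_lower_bound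
    (V := cosetChart hn p₀ ⁻¹' U) (g := fun a => f (cosetChart hn p₀ a)) (C := C.toNNReal)
    (c := c / √n) (fun a => ?_) (fun t a ha hta => ?_) (fun t a ha hta => ?_)
    (by positivity) (fun t ht x y z h₁ h₂ => ?_)
  · obtain ⟨L, hL⟩ := exists_ccDist_dilation_le hn p₀ a
    obtain ⟨r, hr, hU⟩ := hopen p₀ hp₀
    have hlim : Tendsto (fun ε : ℝ => ε * L) (𝓝[>] 0) (𝓝 0) := by
      have : Tendsto (fun ε : ℝ => ε * L) (𝓝 0) (𝓝 (0 * L)) :=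
        (continuous_id.mul continuous_const).tendsto 0
      rw [zero_mul] at this
      exact this.mono_left nhdsWithin_le_nhds
    refine ⟨C * L, ?_⟩
    filter_upwards [hlim.eventually_lt_const hr, self_mem_nhdsWithin] with ε hεr hε
    have hmem := hU _ ((hL ε hε).trans_lt hεr)
    refine ⟨hmem, ?_⟩
    rw [norm_sub_rev, cosetChart_zero]
    calc _ ≤ C * ccDist n p₀ (cosetChart hn p₀ (dilation ε a)) := (hbi _ hp₀ _ hmem).2
      _ ≤ C * (ε * L) := by gcongr; exact hL ε hε
      _ = C * L * ε := by ring
  · rw [hCn]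
    refine (hbi _ hta _ ha).2.trans ?_
    gcongr
    exact ccDist_cosetChart_flowX_le hn p₀ t a
  · rw [hCn]
    refine (hbi _ hta _ ha).2.trans ?_
    gcongr
    exact ccDist_cosetChart_flowY_le hn p₀ t a
  · calc c / √n * t = c * (t / √n) := by ring
      _ ≤ c * ccDist n (cosetChart hn p₀ (x, y, z + t ^ 2)) (cosetChart hn p₀ (x, y, z)) := by
        gcongr
        exact le_ccDist_cosetChart_vertical hn p₀ ht x y z
      _ ≤ _ := (hbi _ h₂ _ h₁).1
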